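/- Let (G, ε) be a signed group with G finite. Then there does not exist a signed group weighing matrix SW(6, 3) over (G, ε). -/

import Mathlib

/-- A signed group: a group `G` together with a distinguished central element `ε`
of order two. -/
structure SignedGroup where
  /-- the underlying group -/
  G : Type
  /-- the group structure -/
  grp : Group G
  /-- the distinguished central element -/
  ε : G
  central : ∀ g : G, ε * g = g * ε
  sq : ε * ε = 1
  ne_one : ε ≠ 1

attribute [instance] SignedGroup.grp

namespace SignedGroup

/-- The number of columns `j` in row `a` whose entry is the variable `x i`
(with some signed-group coefficient). -/
noncomputable def rowCount (S : SignedGroup) {n k : ℕ} (X : Fin n → Fin n → Option (S.G × Fin k))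
    (a : Fin n) (i : Fin k) : ℕ :=
  Nat.card {j : Fin n // ∃ g : S.G, X a j = some (g, i)}

/-- `pairCount S X a b i i' g` is the number of columns `j` for which
`X a j = some (s, i)` and `X b j = some (s', i')` with `s * s'⁻¹ = g`. -/
noncomputable def pairCount (S : SignedGroup) {n k : ℕ} (X : Fin n → Fin n → Option (S.G × Fin k))
    (a b : Fin n) (i i' : Fin k) (g : S.G) : ℕ :=
  Nat.card {j : Fin n //
    ∃ s s' : S.G, X a j = some (s, i) ∧ X b j = some (s', i') ∧ s * s'⁻¹ = g}

/-- `X` is a signed group orthogonal design `SOD(n; u 0, …, u (k-1))` over `S`. -/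
def IsSOD (S : SignedGroup) {n k : ℕ} (u : Fin k → ℕ)
    (X : Fin n → Fin n → Option (S.G × Fin k)) : Prop :=
  (∀ (a : Fin n) (i : Fin k), S.rowCount X a i = u i) ∧
  (∀ a b : Fin n, a ≠ b → ∀ (i i' : Fin k) (g : S.G),
    S.pairCount X a b i i' g + S.pairCount X a b i' i g =
      S.pairCount X a b i i' (S.ε * g) + S.pairCount X a b i' i (S.ε * g))

/-- An SOD is full if it has no zero entries. -/
def IsFull (S : SignedGroup) {n k : ℕ} (X : Fin n → Fin n → Option (S.G × Fin k)) : Prop :=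
  ∀ a b : Fin n, X a b ≠ none

end SignedGroup

namespace SignedGroup

/-- `W` is a signed group weighing matrix `SW(n, w)` over `S`. -/
def IsSW (S : SignedGroup) {n : ℕ} (w : ℕ) (W : Fin n → Fin n → Option S.G) : Prop :=
  (∀ a : Fin n, Nat.card {j : Fin n // W a j ≠ none} = w) ∧
  (∀ a b : Fin n, a ≠ b → ∀ g : S.G,
    Nat.card {j : Fin n // ∃ s s' : S.G, W a j = some s ∧ W b j = some s' ∧ s * s'⁻¹ = g} =
      Nat.card {j : Fin n //
        ∃ s s' : S.G, W a j = some s ∧ W b j = some s' ∧ s * s'⁻¹ = S.ε * g})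

end SignedGroup

namespace SignedGroup

open Finset Classical in
/-- The set of columns in which row `a` of `W` has a nonzero entry. -/
noncomputable def rowSupport {S : SignedGroup} {n : ℕ} (W : Fin n → Fin n → Option S.G)
    (a : Fin n) : Finset (Fin n) :=
  univ.filter fun j => W a j ≠ none

open Finset in
theorem IsSW.card_rowSupport {S : SignedGroup} {n w : ℕ} {W : Fin n → Fin n → Option S.G}
    (hW : S.IsSW w W) (a : Fin n) : #(rowSupport W a) = w := by
  classical
  rw [← hW.1 a, Nat.card_eq_fintype_card, Fintype.card_subtype]
  congr!

open Finset in
/-- The supports of two distinct rows of a signed group weighing matrix over a finite signed group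
meet in an even number of columns, since `g ↦ ε * g` is a fixed-point-free involution preserving
the number of columns with quotient `g`. -/
theorem IsSW.even_card_rowSupport_inter {S : SignedGroup} [Finite S.G] {n w : ℕ}
    {W : Fin n → Fin n → Option S.G} (hW : S.IsSW w W) {a b : Fin n} (hab : a ≠ b) :
    Even #(rowSupport W a ∩ rowSupport W b) := by
  classical
  have := Fintype.ofFinite S.G
  let q : Fin n → S.G := fun j => (W a j).getD 1 * ((W b j).getD 1)⁻¹
  set C := rowSupport W a ∩ rowSupport W b with hC
  have fiber (g : S.G) : Nat.card {j : Fin n // ∃ s s' : S.G,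
      W a j = some s ∧ W b j = some s' ∧ s * s'⁻¹ = g} = #{j ∈ C | q j = g} := by
    rw [Nat.card_eq_fintype_card, Fintype.card_subtype]
    congr 1
    ext j
    cases ha : W a j <;> cases hb : W b j <;> simp [hC, rowSupport, q, ha, hb]
  rw [← ZMod.natCast_eq_zero_iff_even,
    card_eq_sum_card_fiberwise (f := q) (t := univ) (fun _ _ => mem_coe.2 (mem_univ _)),
    Nat.cast_sum]
  refine sum_involution (fun g _ => S.ε * g) (fun g _ => ?_) (fun g _ _ h => ?_)
    (fun _ _ => mem_univ _) (fun g _ => ?_)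
  · rw [← fiber, ← fiber, ← hW.2 a b hab g]
    exact CharTwo.add_self_eq_zero _
  · exact S.ne_one (mul_eq_right.1 h)
  · rw [← mul_assoc, S.sq, one_mul]

end SignedGroup

open Finset in
/-- At most three triples in a six-element set meet a given triple and each other in an even number
of points. -/
theorem not_even_card_inter_of_four_triples :
    let triples : Finset (Finset (Fin 6)) := {X ∈ powersetCard 3 univ | Even #({0, 1, 2} ∩ X)}
    ∀ A ∈ triples, ∀ B ∈ triples, Even #(A ∩ B) →
    ∀ C ∈ triples, Even #(A ∩ C) → Even #(B ∩ C) →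
    ∀ D ∈ triples, Even #(A ∩ D) → Even #(B ∩ D) → ¬ Even #(C ∩ D) := by
  decide +kernel

open Finset in
/-- Any two finsets of the same cardinality are related by a permutation. -/
theorem Finset.exists_perm_map_eq {α : Type*} [Fintype α] [DecidableEq α] {s t : Finset α}
    (h : #s = #t) : ∃ e : Equiv.Perm α, s.map e.toEmbedding = t := by
  let e := (equivOfCardEq h).extendSubtype
  refine ⟨e, eq_of_subset_of_card_le (fun y hy => ?_) (by rw [card_map, h])⟩
  obtain ⟨x, hx, rfl⟩ := mem_map.1 hy
  exact (equivOfCardEq h).extendSubtype_mem x hx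

open Finset SignedGroup in
/-- There does not exist any signed group weighing matrix `SW(6, 3)` over a
finite signed group. -/
theorem no_SW_6_3 (S : SignedGroup) (hG : Finite S.G) :
    ¬ ∃ W : Fin 6 → Fin 6 → Option S.G, S.IsSW 3 W := by
  rintro ⟨W, hW⟩
  obtain ⟨e, he⟩ : ∃ e : Equiv.Perm (Fin 6), (rowSupport W 0).map e.toEmbedding = {0, 1, 2} :=
    exists_perm_map_eq (hW.card_rowSupport 0)
  let R (a : Fin 6) := (rowSupport W a).map e.toEmbedding
  have even {a b} (hab : a ≠ b) : Even #(R a ∩ R b) := by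
    rw [← map_inter, card_map]
    exact hW.even_card_rowSupport_inter hab
  have mem (a) (ha : 0 ≠ a) : R a ∈ (powersetCard 3 univ).filter fun X => Even #({0, 1, 2} ∩ X) :=
    mem_filter.2 ⟨mem_powersetCard.2 ⟨subset_univ _, (card_map _).trans (hW.card_rowSupport a)⟩,
      he ▸ even ha⟩
  exact not_even_card_inter_of_four_triples _ (mem 1 (by decide))
    _ (mem 2 (by decide)) (even (by decide))
    _ (mem 3 (by decide)) (even (by decide)) (even (by decide))
    _ (mem 4 (by decide)) (even (by decide)) (even (by decide)) (even (by decide))
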